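/- arXiv:1809.10848 — 6 statements merged into one kernel-verified Lean document; each statement's English description precedes it below -/
import Mathlib

section
/- Let G(V,E) be a chordal graph on V = {1,...,r} and let C_1,...,C_t be all of the maximal cliques of G. Then a real symmetric r×r matrix X belongs to S_+^r(E,0) if and only if there exist positive semidefinite matrices X_k ∈ S_+^{|C_k|} for k = 1,...,t such that X = Σ_{k=1}^t P_{C_k}^T X_k P_{C_k}. -/
open scoped BigOperators Matrix

noncomputable section

/-- The matrix `P_C ∈ ℝ^{|C|×r}` with `(P_C)_{ij} = 1` if the `i`-th element of `C`
(in the natural ordering, i.e. the element `i` of the subtype) equals `j`, and `0` otherwise. -/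
def cliqueProj {r : ℕ} (C : Finset (Fin r)) : Matrix C (Fin r) ℝ :=
  Matrix.of fun i j => if (i : Fin r) = j then 1 else 0

/-- A graph is chordal if every cycle of length at least four has a chord, i.e. an edge
joining two nonconsecutive nodes of the cycle. Cycles of length `k` are given by
functions `v : ℕ → V` injective on `{0, ..., k-1}` with consecutive vertices
(cyclically) adjacent. -/
def IsChordal {V : Type*} (G : SimpleGraph V) : Prop :=
  ∀ (k : ℕ) (v : ℕ → V), 4 ≤ k →
    (∀ i j, i < k → j < k → v i = v j → i = j) →
    (∀ i < k, G.Adj (v i) (v ((i + 1) % k))) →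
    ∃ i j, i < k ∧ j < k ∧ i ≠ j ∧ j ≠ (i + 1) % k ∧ i ≠ (j + 1) % k ∧ G.Adj (v i) (v j)

namespace SimpleGraph

variable {V : Type*}

/-- The subgraph of `G` on the same vertex type keeping only the edges with both ends in `s`. -/
def edgesWithin (G : SimpleGraph V) (s : Set V) : SimpleGraph V where
  Adj x y := G.Adj x y ∧ x ∈ s ∧ y ∈ s
  symm := ⟨fun _ _ h => ⟨h.1.symm, h.2.2, h.2.1⟩⟩
  loopless := ⟨fun _ h => h.1.ne rfl⟩

lemma edgesWithin_mono (G : SimpleGraph V) {s t : Set V} (h : s ⊆ t) :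
    G.edgesWithin s ≤ G.edgesWithin t :=
  fun _ _ hxy => ⟨hxy.1, h hxy.2.1, h hxy.2.2⟩

lemma Walk.dist_getVert_of_length_eq_dist {H : SimpleGraph V} {a b : V} (p : H.Walk a b)
    (hp : p.length = H.dist a b) {i : ℕ} (hi : i ≤ p.length) : H.dist a (p.getVert i) = i := by
  have h₁ := dist_le (p.take i)
  have h₂ := dist_le (p.drop i)
  have h₃ := (p.take i).reachable.dist_triangle_left b
  simp only [Walk.take_length, Walk.drop_length] at h₁ h₂
  omega

/-- In a chordal graph, two neighbours of `u` that are joined by a path through non-neighbours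
of `u` are adjacent. -/
lemma adj_of_reachable_edgesWithin {G : SimpleGraph V} (hG : IsChordal G) {u a b : V} {Q : Set V}
    (hQ : ∀ x ∈ Q, x ≠ u ∧ ¬ G.Adj u x) (ha : G.Adj u a) (hb : G.Adj u b) (hab : a ≠ b)
    (hr : (G.edgesWithin (Q ∪ {a, b})).Reachable a b) : G.Adj a b := by
  by_contra hnadj
  set H := G.edgesWithin (Q ∪ {a, b}) with hH
  obtain ⟨p, hp⟩ := hr.exists_walk_length_eq_dist
  have hlt : 1 < p.length := by
    rw [hp]
    exact hr.one_lt_dist_of_ne_of_not_adj hab fun h => hnadj h.1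
  set n := p.length with hn
  have hdist : ∀ i ≤ n, H.dist a (p.getVert i) = i := fun i hi =>
    p.dist_getVert_of_length_eq_dist hp hi
  have hadj : ∀ i < n, H.Adj (p.getVert i) (p.getVert (i + 1)) := fun i hi =>
    p.adj_getVert_succ hi
  have hmem : ∀ i ≤ n, p.getVert i ∈ Q ∪ {a, b} := by
    intro i hi
    rcases Nat.lt_or_ge i n with h | h
    · exact (hadj i h).2.1
    · rw [p.getVert_of_length_le h]; simp
  have hne : ∀ i ≤ n, p.getVert i ≠ u := by
    intro i hi h
    rcases hmem i hi with h' | h' | h'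
    · exact (hQ _ h').1 h
    · exact ha.ne (h.symm.trans h')
    · exact hb.ne (h.symm.trans h')
  have hu : ∀ i ≤ n, G.Adj u (p.getVert i) → i = 0 ∨ i = n := by
    intro i hi h
    rcases hmem i hi with h' | h' | h'
    · exact absurd h (hQ _ h').2
    · left
      rw [← hdist i hi, h', dist_self]
    · right
      rw [← hdist i hi, h', ← hp]
  have hchord : ∀ i ≤ n, ∀ j ≤ n, G.Adj (p.getVert i) (p.getVert j) → j ≤ i + 1 := by
    intro i hi j hj h
    have hH' : H.Adj (p.getVert i) (p.getVert j) := ⟨h, hmem i hi, hmem j hj⟩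
    have h₁ := hH'.reachable.dist_triangle_right a
    rw [hdist i hi, hdist j hj, dist_eq_one_iff_adj.2 hH'] at h₁
    exact h₁
  let v : ℕ → V := fun i => if i ≤ n then p.getVert i else u
  have hv : ∀ i ≤ n, v i = p.getVert i := fun i hi => if_pos hi
  have hv' : v (n + 1) = u := if_neg (by omega)
  have hinj : ∀ i j, i < n + 2 → j < n + 2 → v i = v j → i = j := by
    intro i j hi hj h
    rcases Nat.lt_or_ge i (n + 1) with hin | hin <;> rcases Nat.lt_or_ge j (n + 1) with hjn | hjn
    · rw [hv i (by omega), hv j (by omega)] at h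
      rw [← hdist i (by omega), ← hdist j (by omega), h]
    · obtain rfl : j = n + 1 := by omega
      rw [hv i (by omega), hv'] at h
      exact absurd h (hne i (by omega))
    · obtain rfl : i = n + 1 := by omega
      rw [hv j (by omega), hv'] at h
      exact absurd h.symm (hne j (by omega))
    · omega
  have hcyc : ∀ i < n + 2, G.Adj (v i) (v ((i + 1) % (n + 2))) := by
    intro i hi
    rcases Nat.lt_trichotomy i n with hin | hin | hin
    · rw [Nat.mod_eq_of_lt (by omega), hv i (by omega), hv (i + 1) (by omega)]
      exact (hadj i hin).1
    · rw [Nat.mod_eq_of_lt (by omega), hin, hv n le_rfl, hv', p.getVert_length]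
      exact hb.symm
    · obtain rfl : i = n + 1 := by omega
      rw [Nat.mod_self, hv', hv 0 (by omega), p.getVert_zero]
      exact ha
  obtain ⟨i, j, hi, hj, hij, hj', hi', h⟩ := hG (n + 2) v (by omega) hinj hcyc
  rcases Nat.lt_or_ge i (n + 1) with hin | hin <;> rcases Nat.lt_or_ge j (n + 1) with hjn | hjn
  · rw [Nat.mod_eq_of_lt (by omega)] at hi' hj'
    rw [hv i (by omega), hv j (by omega)] at h
    have := hchord i (by omega) j (by omega) h
    have := hchord j (by omega) i (by omega) h.symm
    omega
  · obtain rfl : j = n + 1 := by omega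
    rw [hv i (by omega), hv'] at h
    rw [Nat.mod_eq_of_lt (by omega)] at hj'
    rw [Nat.mod_self] at hi'
    rcases hu i (by omega) h.symm with h | h <;> omega
  · obtain rfl : i = n + 1 := by omega
    rw [hv j (by omega), hv'] at h
    rw [Nat.mod_eq_of_lt (by omega)] at hi'
    rw [Nat.mod_self] at hj'
    rcases hu j (by omega) h with h | h <;> omega
  · omega

/-- **Dirac lemma** relative to a vertex: in a chordal graph, if `u` is not adjacent to every
other vertex of `S`, then `S` contains a simplicial vertex not adjacent to `u`. -/
lemma exists_simplicial_not_adj {G : SimpleGraph V} (hG : IsChordal G) (S : Finset V) :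
    ∀ u ∈ S, ∀ c ∈ S, c ≠ u → ¬ G.Adj u c →
      ∃ v ∈ S, v ≠ u ∧ ¬ G.Adj u v ∧ G.IsClique {w | w ∈ S ∧ G.Adj v w} := by
  classical
  induction S using Finset.strongInduction with
  | H S ih =>
  intro u hu c hc hcu huc
  let Q : Set V := {x | x ∈ S ∧ x ≠ u ∧ ¬ G.Adj u x}
  let K := G.edgesWithin Q
  let B : Finset V := S.filter fun x => x ∈ Q ∧ K.Reachable c x
  let N : Finset V := S.filter fun x => x ∉ Q ∧ ∃ y ∈ B, G.Adj x y
  have hB : ∀ x, x ∈ B ↔ x ∈ Q ∧ K.Reachable c x := fun x => by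
    simp only [B, Finset.mem_filter, and_iff_right_iff_imp]
    exact fun h => h.1.1
  have hN : ∀ x, x ∈ N ↔ x ∈ S ∧ x ∉ Q ∧ ∃ y ∈ B, G.Adj x y := fun x => by
    simp only [N, Finset.mem_filter]
  have hcB : c ∈ B := (hB c).2 ⟨⟨hc, hcu, huc⟩, Reachable.refl _⟩
  have hNu : ∀ x ∈ N, G.Adj u x := by
    intro x hx
    obtain ⟨hxS, hxQ, y, hy, hxy⟩ := (hN x).1 hx
    by_contra h
    refine hxQ ⟨hxS, ?_, h⟩
    rintro rfl
    exact ((hB y).1 hy).1.2.2 hxy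
  have hNclique : ∀ a ∈ N, ∀ b ∈ N, a ≠ b → G.Adj a b := by
    intro a ha b hb hab
    obtain ⟨-, -, y, hy, hay⟩ := (hN a).1 ha
    obtain ⟨-, -, z, hz, hbz⟩ := (hN b).1 hb
    have hy' := (hB y).1 hy
    have hz' := (hB z).1 hz
    refine adj_of_reachable_edgesWithin hG (Q := Q) (fun x hx => hx.2) (hNu a ha) (hNu b hb) hab ?_
    have h₁ : (G.edgesWithin (Q ∪ {a, b})).Adj a y := ⟨hay, by simp, Or.inl hy'.1⟩
    have h₂ : (G.edgesWithin (Q ∪ {a, b})).Adj b z := ⟨hbz, by simp, Or.inl hz'.1⟩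
    have h₃ : (G.edgesWithin (Q ∪ {a, b})).Reachable y z :=
      (hy'.2.symm.trans hz'.2).mono (G.edgesWithin_mono Set.subset_union_left)
    exact h₁.reachable.trans (h₃.trans h₂.reachable.symm)
  have hclosed : ∀ x ∈ B, ∀ w ∈ S, G.Adj x w → w ∈ B ∪ N := by
    intro x hx w hw hxw
    rw [Finset.mem_union]
    have hx' := (hB x).1 hx
    by_cases hwQ : w ∈ Q
    · have : K.Adj x w := ⟨hxw, hx'.1, hwQ⟩
      exact Or.inl ((hB w).2 ⟨hwQ, hx'.2.trans this.reachable⟩)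
    · exact Or.inr ((hN w).2 ⟨hw, hwQ, x, hx, hxw.symm⟩)
  have hssub : B ∪ N ⊂ S := by
    refine (Finset.ssubset_iff_of_subset
      (Finset.union_subset (Finset.filter_subset _ _) (Finset.filter_subset _ _))).2 ⟨u, hu, ?_⟩
    rw [Finset.mem_union]
    rintro (h | h)
    · exact ((hB u).1 h).1.2.1 rfl
    · exact (hNu u h).ne rfl
  suffices h : ∃ x ∈ B, G.IsClique {w | w ∈ B ∪ N ∧ G.Adj x w} by
    obtain ⟨x, hx, hcl⟩ := h
    have hxQ := ((hB x).1 hx).1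
    exact ⟨x, hxQ.1, hxQ.2.1, hxQ.2.2, fun a ha b hb hab =>
      hcl ⟨hclosed x hx a ha.1 ha.2, ha.2⟩ ⟨hclosed x hx b hb.1 hb.2, hb.2⟩ hab⟩
  by_cases h₁ : ∃ w ∈ N, ∃ z ∈ B ∪ N, z ≠ w ∧ ¬ G.Adj w z
  · obtain ⟨w, hw, z, hz, hzw, hwz⟩ := h₁
    obtain ⟨x, hx, hxw, hwx, hcl⟩ := ih _ hssub w (Finset.mem_union_right _ hw) z hz hzw hwz
    refine ⟨x, (Finset.mem_union.1 hx).resolve_right fun hxN => ?_, hcl⟩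
    exact hwx (hNclique w hw x hxN hxw.symm)
  push Not at h₁
  by_cases h₂ : ∃ w ∈ B, ∃ z ∈ B ∪ N, z ≠ w ∧ ¬ G.Adj w z
  · obtain ⟨w, hw, z, hz, hzw, hwz⟩ := h₂
    obtain ⟨x, hx, hxw, hwx, hcl⟩ := ih _ hssub w (Finset.mem_union_left _ hw) z hz hzw hwz
    refine ⟨x, (Finset.mem_union.1 hx).resolve_right fun hxN => ?_, hcl⟩
    exact hwx (h₁ x hxN w (Finset.mem_union_left _ hw) hxw.symm).symm
  push Not at h₂
  refine ⟨c, hcB, fun a ha b hb hab => ?_⟩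
  rcases Finset.mem_union.1 ha.1 with h | h
  · exact h₂ a h b hb.1 hab.symm
  · exact h₁ a h b hb.1 hab.symm

lemma exists_simplicial {G : SimpleGraph V} (hG : IsChordal G) {S : Finset V} (hS : S.Nonempty) :
    ∃ v ∈ S, G.IsClique {w | w ∈ S ∧ G.Adj v w} := by
  by_cases h : ∃ u ∈ S, ∃ c ∈ S, c ≠ u ∧ ¬ G.Adj u c
  · obtain ⟨u, hu, c, hc, hcu, huc⟩ := h
    obtain ⟨v, hv, -, -, hcl⟩ := exists_simplicial_not_adj hG S u hu c hc hcu huc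
    exact ⟨v, hv, hcl⟩
  · push Not at h
    obtain ⟨v, hv⟩ := hS
    exact ⟨v, hv, fun a ha b hb hab => h a ha.1 b hb.1 hab.symm⟩

end SimpleGraph

namespace Matrix

variable {n : Type*} [Fintype n]

lemma PosSemidef.apply_eq_zero_of_diag_eq_zero {X : Matrix n n ℝ} (hX : X.PosSemidef) {v : n}
    (hv : X v v = 0) (i : n) : X i v = 0 := by
  classical
  have h := (hX.dotProduct_mulVec_zero_iff (Pi.single v 1)).1 (by simp [hv])
  simpa using congrFun h i

/-- Eliminating one row and column of a positive semidefinite matrix (a Cholesky step) leaves a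
positive semidefinite matrix. -/
lemma PosSemidef.sub_smul_vecMulVec {X : Matrix n n ℝ} (hX : X.PosSemidef) {v : n}
    (hv : X v v ≠ 0) :
    (X - (X v v)⁻¹ • vecMulVec (X v) (X v)).PosSemidef := by
  classical
  have hs : ∀ i j, X i j = X j i := fun i j => by simpa using hX.1.apply j i
  convert hX.conjTranspose_mul_mul_same (1 - (X v v)⁻¹ • vecMulVec (Pi.single v 1) (X v)) using 1
  have h₁ : X * vecMulVec (Pi.single v 1) (X v) = vecMulVec (X v) (X v) := by
    ext i j
    simp [mul_vecMulVec, vecMulVec_apply, hs i v]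
  have h₂ : vecMulVec (X v) (Pi.single v 1) * X = vecMulVec (X v) (X v) := by
    ext i j
    simp [vecMulVec_mul, vecMulVec_apply]
  have h₃ : vecMulVec (X v) (Pi.single v 1) * vecMulVec (X v) (X v) =
      X v v • vecMulVec (X v) (X v) := by
    ext i j
    simp [vecMulVec_mul_vecMulVec, vecMulVec_apply, mul_left_comm]
  have h₄ : (vecMulVec (Pi.single v 1) (X v))ᴴ = vecMulVec (X v) (Pi.single v 1) := by
    ext i j
    simp [vecMulVec_apply, mul_comm]
  generalize vecMulVec (Pi.single v 1) (X v) = E at *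
  generalize vecMulVec (X v) (Pi.single v 1) = F at *
  generalize vecMulVec (X v) (X v) = R at *
  have h₅ : R * E = X v v • R := by rw [← h₂, Matrix.mul_assoc, h₁, h₃, h₂]
  rw [conjTranspose_sub, conjTranspose_smul, h₄, conjTranspose_one]
  simp [sub_mul, mul_sub, h₁, h₂, h₅, smul_smul, hv]

/-- The rank one matrices `x xᵀ` with `x` supported on a clique of `G`. -/
def cliqueRankOne (G : SimpleGraph n) : Set (Matrix n n ℝ) :=
  {A | ∃ x : n → ℝ, (∃ s : Finset n, G.IsClique s ∧ ∀ i ∉ s, x i = 0) ∧ A = vecMulVec x x}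

lemma PosSemidef.mem_closure_cliqueRankOne {G : SimpleGraph n} (hG : IsChordal G) (S : Finset n) :
    ∀ X : Matrix n n ℝ, X.PosSemidef → (∀ i j, i ≠ j → ¬ G.Adj i j → X i j = 0) →
      (∀ i j, i ∉ S → X i j = 0) → X ∈ AddSubmonoid.closure (cliqueRankOne G) := by
  classical
  induction S using Finset.strongInduction with
  | H S ih =>
  intro X hX hpat hsupp
  have hs : ∀ i j, X i j = X j i := fun i j => by simpa using hX.1.apply j i
  rcases S.eq_empty_or_nonempty with rfl | hS
  · have : X = 0 := by
      ext i j
      exact hsupp i j (Finset.notMem_empty i)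
    rw [this]
    exact zero_mem _
  obtain ⟨v, hv, hcl⟩ := SimpleGraph.exists_simplicial hG hS
  have hlt := Finset.erase_ssubset hv
  by_cases hvv : X v v = 0
  · refine ih _ hlt X hX hpat fun i j hi => ?_
    by_cases hiv : i = v
    · rw [hiv, hs]
      exact hX.apply_eq_zero_of_diag_eq_zero hvv j
    · exact hsupp i j fun h => hi (Finset.mem_erase.2 ⟨hiv, h⟩)
  have hpos : 0 < X v v := lt_of_le_of_ne hX.diag_nonneg (Ne.symm hvv)
  have hnbr : ∀ i, X v i ≠ 0 → i ≠ v → i ∈ S ∧ G.Adj v i := by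
    refine fun i hi hiv => ⟨?_, ?_⟩
    · by_contra h
      exact hi (by rw [hs, hsupp i v h])
    · by_contra h
      exact hi (hpat v i hiv.symm h)
  have hsplit : X = (X - (X v v)⁻¹ • vecMulVec (X v) (X v)) +
      (X v v)⁻¹ • vecMulVec (X v) (X v) := by simp
  have hclique : G.IsClique ((Finset.univ.filter fun i => X v i ≠ 0 : Finset n) : Set n) := by
    intro a ha b hb hab
    simp only [Finset.coe_filter, Finset.mem_univ, true_and, Set.mem_ofPred_eq] at ha hb
    by_cases hav : a = v
    · subst hav
      exact (hnbr b hb hab.symm).2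
    by_cases hbv : b = v
    · subst hbv
      exact (hnbr a ha hab).2.symm
    exact hcl (hnbr a ha hav) (hnbr b hb hbv) hab
  rw [hsplit]
  refine add_mem (ih _ hlt _ (hX.sub_smul_vecMulVec hvv) ?_ ?_) (AddSubmonoid.subset_closure ?_)
  · intro i j hij hadj
    have h : X v i = 0 ∨ X v j = 0 := by
      by_contra! h
      exact hadj (hclique (by simpa using h.1) (by simpa using h.2) hij)
    rcases h with h | h <;> simp [vecMulVec_apply, h, hpat i j hij hadj]
  · intro i j hi
    by_cases hiv : i = v
    · subst hiv
      simp [vecMulVec_apply, hvv]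
    · have hiS : i ∉ S := fun h => hi (Finset.mem_erase.2 ⟨hiv, h⟩)
      simp [vecMulVec_apply, hsupp i _ hiS, hs v i]
  · refine ⟨(√(X v v))⁻¹ • X v, ⟨_, hclique, fun i hi => ?_⟩, ?_⟩
    · simp only [Finset.mem_filter, Finset.mem_univ, true_and, not_not] at hi
      simp [hi]
    · ext i j
      have h : (X v v)⁻¹ = (√(X v v))⁻¹ * (√(X v v))⁻¹ := by
        rw [← mul_inv, Real.mul_self_sqrt hpos.le]
      simp only [smul_apply, vecMulVec_apply, Pi.smul_apply, smul_eq_mul, h]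
      ring

end Matrix

lemma cliqueProj_conj_apply_of_notMem {r : ℕ} (C : Finset (Fin r)) (Y : Matrix C C ℝ)
    {i j : Fin r} (h : i ∉ C ∨ j ∉ C) : ((cliqueProj C)ᵀ * Y * cliqueProj C) i j = 0 := by
  rcases h with h | h
  · rw [Matrix.mul_assoc, Matrix.mul_apply]
    refine Finset.sum_eq_zero fun a _ => ?_
    have : (a : Fin r) ≠ i := fun e => h (e ▸ a.2)
    simp [cliqueProj, this]
  · rw [Matrix.mul_apply]
    refine Finset.sum_eq_zero fun a _ => ?_
    have : (a : Fin r) ≠ j := fun e => h (e ▸ a.2)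
    simp [cliqueProj, this]

lemma vecMul_cliqueProj {r : ℕ} {C : Finset (Fin r)} {x : Fin r → ℝ} (hx : ∀ i ∉ C, x i = 0) :
    (fun a : C => x a) ᵥ* cliqueProj C = x := by
  ext j
  simp only [Matrix.vecMul, dotProduct, cliqueProj, Matrix.of_apply, mul_ite, mul_one, mul_zero]
  rw [Finset.sum_coe_sort C fun a => if a = j then x a else 0, Finset.sum_ite_eq']
  split_ifs with h
  · rfl
  · exact (hx j h).symm

lemma cliqueProj_conj_vecMulVec {r : ℕ} {C : Finset (Fin r)} {x : Fin r → ℝ}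
    (hx : ∀ i ∉ C, x i = 0) :
    (cliqueProj C)ᵀ * Matrix.vecMulVec (fun a : C => x a) (fun a : C => x a) * cliqueProj C =
      Matrix.vecMulVec x x := by
  rw [Matrix.mul_vecMulVec, Matrix.vecMulVec_mul, Matrix.mulVec_transpose, vecMul_cliqueProj hx]

/-- **Agler–Helton–McCullough–Rodman theorem.**
Let `G` be a chordal graph on `{1,...,r}` whose maximal cliques are exactly
`C 1, ..., C t`.  A real symmetric `r × r` matrix `X` belongs to `S₊^r(E,0)`
(i.e. is positive semidefinite with `X i j = 0` whenever `i ≠ j` and `(i,j)` is not an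
edge) if and only if there are positive semidefinite matrices `Y k ∈ S₊^{|C k|}` with
`X = ∑ k, (P_{C k})ᵀ * Y k * P_{C k}`. -/
theorem chordal_psd_decomposition {r t : ℕ} (G : SimpleGraph (Fin r))
    (hchordal : IsChordal G)
    (C : Fin t → Finset (Fin r))
    (hmax : ∀ s : Finset (Fin r),
      (G.IsClique ↑s ∧ ∀ s' : Finset (Fin r), G.IsClique ↑s' → s ⊆ s' → s' = s) ↔
        ∃ k, C k = s)
    (X : Matrix (Fin r) (Fin r) ℝ) :
    (X.PosSemidef ∧ ∀ i j, i ≠ j → ¬ G.Adj i j → X i j = 0) ↔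
      ∃ Y : (k : Fin t) → Matrix (C k) (C k) ℝ,
        (∀ k, (Y k).PosSemidef) ∧
        X = ∑ k, (cliqueProj (C k))ᵀ * Y k * cliqueProj (C k) := by
  classical
  constructor
  · rintro ⟨hX, hpat⟩
    have hmem :=
      Matrix.PosSemidef.mem_closure_cliqueRankOne hchordal Finset.univ X hX hpat (by simp)
    clear hX hpat
    induction hmem using AddSubmonoid.closure_induction with
    | zero => exact ⟨0, fun _ => Matrix.PosSemidef.zero, by simp⟩
    | add A B _ _ hA hB =>
      obtain ⟨Y, hY, rfl⟩ := hA
      obtain ⟨Z, hZ, rfl⟩ := hB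
      refine ⟨Y + Z, fun k => (hY k).add (hZ k), ?_⟩
      simp [Matrix.mul_add, Matrix.add_mul, Finset.sum_add_distrib]
    | mem A hA =>
      obtain ⟨x, ⟨s, hs, hx⟩, rfl⟩ := hA
      obtain ⟨m, hsm, hm⟩ := Finite.exists_le_maximal
        (p := fun s : Finset (Fin r) => G.IsClique (s : Set (Fin r))) hs
      obtain ⟨k, rfl⟩ := (hmax m).1
        ⟨hm.prop, fun s' hs' hle => le_antisymm (hm.le_of_ge hs' hle) hle⟩
      refine ⟨Pi.single k (Matrix.vecMulVec (fun a => x a) fun a => x a), fun l => ?_, ?_⟩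
      · rcases eq_or_ne l k with rfl | hl
        · rw [Pi.single_eq_same]
          exact Matrix.posSemidef_vecMulVec_self_star fun a : C l => x a
        · rw [Pi.single_eq_of_ne hl]
          exact Matrix.PosSemidef.zero
      · rw [Finset.sum_eq_single k]
        · rw [Pi.single_eq_same, cliqueProj_conj_vecMulVec fun i hi => hx i fun h => hi (hsm h)]
        · intro l _ hl
          rw [Pi.single_eq_of_ne hl, Matrix.mul_zero, Matrix.zero_mul]
        · exact fun h => absurd (Finset.mem_univ k) h
  · rintro ⟨Y, hY, rfl⟩
    refine ⟨Matrix.posSemidef_sum _ fun k _ => ?_, fun i j hij hadj => ?_⟩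
    · exact (hY k).conjTranspose_mul_mul_same (cliqueProj (C k))
    · rw [Matrix.sum_apply]
      refine Finset.sum_eq_zero fun k _ => cliqueProj_conj_apply_of_notMem _ _ ?_
      by_contra! h
      exact hadj (((hmax (C k)).2 ⟨k, rfl⟩).1 h.1 h.2 hij)
end
end

section
/- Let 𝒜 ⊆ ℕ^n be finite, let ℬ = {ω_1,...,ω_r} ⊆ ℕ^n be the support set of a monomial basis, and let G̃(V_𝒜, Ẽ_𝒜) be a chordal extension of the cross sparsity pattern graph G(V_𝒜, E_𝒜), with maximal cliques C_1,...,C_t ⊆ V_𝒜. Set ℬ_k = {ω_i ∈ ℬ : i ∈ C_k} for k = 1,...,t. Then a polynomial f(x) belongs to Σ̃(𝒜) = {f ∈ ℝ[𝒜] : ∃ Q ∈ S_+^r(Ẽ_𝒜,0) with f = (x^ℬ)^T Q x^ℬ} if and only if there exist polynomials f_k(x) ∈ ℝ[ℬ_k]² for k = 1,...,t such that f(x) = Σ_{k=1}^t f_k(x). -/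
open scoped BigOperators Matrix

noncomputable section

/-- The vertex `s` of `S` is simplicial in the subgraph of `G` induced by `S`: its neighbours in
`S` are pairwise adjacent. -/
def IsSimplicialIn {V : Type*} (G : SimpleGraph V) (S : Finset V) (s : V) : Prop :=
  s ∈ S ∧ ∀ u ∈ S, ∀ w ∈ S, G.Adj s u → G.Adj s w → u ≠ w → G.Adj u w

/-- In a chordal graph, if `x ≠ y` are neighbours of `a` that are joined by a path all of whose
inner vertices lie in a set containing neither `a` nor a neighbour of `a`, then `x` and `y` are
adjacent. -/
theorem IsChordal.adj_of_reachable {V : Type*} {G H : SimpleGraph V} (hG : IsChordal G)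
    {B : Set V} {a x y : V} (hHG : ∀ u w, H.Adj u w ↔
      G.Adj u w ∧ (u ∈ B ∨ u = x ∨ u = y) ∧ (w ∈ B ∨ w = x ∨ w = y))
    (haB : a ∉ B) (hB : ∀ u ∈ B, ¬ G.Adj a u) (hx : G.Adj a x) (hy : G.Adj a y) (hxy : x ≠ y)
    (hr : H.Reachable x y) : G.Adj x y := by
  by_contra hnadj
  obtain ⟨p, hp⟩ := hr.exists_walk_length_eq_dist
  have hpath := p.isPath_of_length_eq_dist hp
  have hinj : ∀ i j, i ≤ p.length → j ≤ p.length → p.getVert i = p.getVert j → i = j :=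
    fun i j hi hj h => hpath.getVert_injOn hi hj h
  have hmem : ∀ i ≤ p.length, p.getVert i ∈ B ∨ p.getVert i = x ∨ p.getVert i = y := by
    intro i hi
    rcases hi.eq_or_lt with rfl | hi
    · simp
    · exact ((hHG _ _).1 (p.adj_getVert_succ hi)).2.1
  have hshort : ∀ i j, i + 1 < j → j ≤ p.length → ¬ G.Adj (p.getVert i) (p.getVert j) := by
    intro i j hij hj hadj
    have hH : H.Adj (p.getVert i) (p.getVert j) :=
      (hHG _ _).2 ⟨hadj, hmem i (by omega), hmem j hj⟩
    have := SimpleGraph.dist_le ((p.take i).append (SimpleGraph.Walk.cons hH (p.drop j)))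
    simp only [SimpleGraph.Walk.length_append, SimpleGraph.Walk.length_cons,
      SimpleGraph.Walk.take_length, SimpleGraph.Walk.drop_length] at this
    omega
  have hend : ∀ i ≤ p.length, G.Adj a (p.getVert i) → i = 0 ∨ i = p.length := by
    intro i hi hadj
    rcases hmem i hi with h | h | h
    · exact absurd hadj (hB _ h)
    · exact .inl (hinj _ _ hi (by omega) (by simpa using h))
    · exact .inr (hinj _ _ hi le_rfl (by simpa using h))
  have hne : ∀ i ≤ p.length, p.getVert i ≠ a := by
    intro i hi h
    rcases hmem i hi with h' | h' | h'
    · exact haB (h ▸ h')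
    · exact hx.ne (h.symm.trans h')
    · exact hy.ne (h.symm.trans h')
  have hlen : 2 ≤ p.length := by
    by_contra! hlt
    interval_cases hl : p.length
    · exact hxy (SimpleGraph.Walk.eq_of_length_eq_zero hl)
    · exact hnadj ((hHG _ _).1 (SimpleGraph.Walk.adj_of_length_eq_one hl)).1
  let v : ℕ → V := fun i => if i ≤ p.length then p.getVert i else a
  have hv : ∀ i ≤ p.length, v i = p.getVert i := fun i hi => if_pos hi
  have hva : v (p.length + 1) = a := if_neg (by omega)
  obtain ⟨i, j, hi, hj, hij, hij₁, hij₂, hadj⟩ := hG (p.length + 2) v (by omega) (by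
      intro i j hi hj h
      rcases (Nat.lt_succ_iff.1 hi).eq_or_lt with rfl | hi
      · rcases (Nat.lt_succ_iff.1 hj).eq_or_lt with rfl | hj
        · rfl
        · rw [hva, hv j (by omega)] at h
          exact absurd h.symm (hne j (by omega))
      · rcases (Nat.lt_succ_iff.1 hj).eq_or_lt with rfl | hj
        · rw [hva, hv i (by omega)] at h
          exact absurd h (hne i (by omega))
        · rw [hv i (by omega), hv j (by omega)] at h
          exact hinj i j (by omega) (by omega) h) (by
      intro i hi
      rcases (Nat.lt_succ_iff.1 hi).eq_or_lt with rfl | hi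
      · rw [Nat.mod_self, hva, hv 0 (by omega)]
        simpa using hx
      · rw [Nat.mod_eq_of_lt (by omega), hv i (by omega)]
        rcases (Nat.lt_succ_iff.1 hi).eq_or_lt with rfl | hi
        · rw [hva]
          simpa using hy.symm
        · rw [hv (i + 1) (by omega)]
          exact ((hHG _ _).1 (p.adj_getVert_succ hi)).1)
  have key : ∀ i j, i < j → j < p.length + 2 → j ≠ (i + 1) % (p.length + 2) →
      i ≠ (j + 1) % (p.length + 2) → ¬ G.Adj (v i) (v j) := by
    intro i j hij hj h₁ h₂ hadj
    rw [Nat.mod_eq_of_lt (by omega)] at h₁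
    rcases (Nat.lt_succ_iff.1 hj).eq_or_lt with rfl | hj
    · rw [Nat.mod_self] at h₂
      rw [hva, hv i (by omega)] at hadj
      rcases hend i (by omega) hadj.symm with h | h <;> omega
    · rw [hv i (by omega), hv j (by omega)] at hadj
      exact hshort i j (by omega) (by omega) hadj
  rcases hij.lt_or_gt with h | h
  · exact key i j h hj hij₁ hij₂ hadj
  · exact key j i h hi hij₂ hij₁ hadj.symm

open Classical in
/-- A vertex of a finite set `S` of vertices of a chordal graph that is not adjacent to all of `S`
has a simplicial non-neighbour. -/
theorem IsChordal.exists_isSimplicialIn_not_adj {V : Type*} {G : SimpleGraph V}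
    (hG : IsChordal G) (S : Finset V) {a b : V} (ha : a ∈ S) (hb : b ∈ S) (hab : a ≠ b)
    (hnab : ¬ G.Adj a b) : ∃ s, IsSimplicialIn G S s ∧ s ≠ a ∧ ¬ G.Adj a s := by
  induction S using Finset.strongInduction generalizing a b with
  | H S ih =>
    let K : V → V → Prop := fun u w => G.Adj u w ∧ w ∈ S ∧ w ≠ a ∧ ¬ G.Adj a w
    let B : Set V := {v | Relation.ReflTransGen K b v}
    have hbB : b ∈ B := Relation.ReflTransGen.refl
    have hBR : ∀ v ∈ B, v ∈ S ∧ v ≠ a ∧ ¬ G.Adj a v := by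
      intro v hv
      rcases Relation.ReflTransGen.cases_tail hv with rfl | ⟨u, -, huv⟩
      · exact ⟨hb, hab.symm, hnab⟩
      · exact huv.2
    have hstep : ∀ u ∈ B, ∀ w ∈ S, G.Adj u w → w ∉ B → G.Adj a w := by
      intro u hu w hw huw hwB
      by_contra haw
      refine hwB (Relation.ReflTransGen.tail hu ⟨huw, hw, ?_, haw⟩)
      rintro rfl
      exact (hBR u hu).2.2 huw.symm
    let D : Finset V := S.filter fun v => v ∈ B ∨ ∃ u ∈ B, G.Adj u v
    have hBD : ∀ v ∈ B, v ∈ D := fun v hv => Finset.mem_filter.2 ⟨(hBR v hv).1, .inl hv⟩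
    have hDS : D ⊂ S := by
      refine (Finset.ssubset_iff_of_subset (Finset.filter_subset _ _)).2 ⟨a, ha, fun haD => ?_⟩
      rcases (Finset.mem_filter.1 haD).2 with h | ⟨u, hu, h⟩
      · exact (hBR a h).2.1 rfl
      · exact (hBR u hu).2.2 h.symm
    have hclique : ∀ x ∈ D, x ∉ B → ∀ y ∈ D, y ∉ B → x ≠ y → G.Adj x y := by
      intro x hxD hxB y hyD hyB hxy
      obtain ⟨hxS, hx⟩ := Finset.mem_filter.1 hxD
      obtain ⟨hyS, hy⟩ := Finset.mem_filter.1 hyD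
      obtain ⟨u, hu, hux⟩ := hx.resolve_left hxB
      obtain ⟨w, hw, hwy⟩ := hy.resolve_left hyB
      let H : SimpleGraph V :=
        { Adj := fun u w => G.Adj u w ∧ (u ∈ B ∨ u = x ∨ u = y) ∧ (w ∈ B ∨ w = x ∨ w = y)
          symm := ⟨fun _ _ h => ⟨h.1.symm, h.2.2, h.2.1⟩⟩
          loopless := ⟨fun _ h => h.1.ne rfl⟩ }
      have hreach : ∀ v ∈ B, H.Reachable b v := by
        intro v hv
        induction hv with
        | refl => exact SimpleGraph.Reachable.refl _
        | @tail c d hc hcd h =>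
          have hHcd : H.Adj c d :=
            ⟨hcd.1, .inl hc, .inl (Relation.ReflTransGen.tail hc hcd)⟩
          exact h.trans hHcd.reachable
      have hHux : H.Adj u x := ⟨hux, .inl hu, .inr (.inl rfl)⟩
      have hHwy : H.Adj w y := ⟨hwy, .inl hw, .inr (.inr rfl)⟩
      exact hG.adj_of_reachable (H := H) (fun _ _ => Iff.rfl) (fun h => (hBR a h).2.1 rfl)
        (fun v hv => (hBR v hv).2.2) (hstep u hu x hxS hux hxB) (hstep w hw y hyS hwy hyB) hxy
        (((hreach u hu).trans hHux.reachable).symm.trans ((hreach w hw).trans hHwy.reachable))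
    have hlift : ∀ s ∈ B, IsSimplicialIn G D s →
        ∃ s, IsSimplicialIn G S s ∧ s ≠ a ∧ ¬ G.Adj a s := by
      intro s hs hsimp
      refine ⟨s, ⟨(hBR s hs).1, fun u hu w hw hsu hsw => ?_⟩, (hBR s hs).2⟩
      exact hsimp.2 u (Finset.mem_filter.2 ⟨hu, .inr ⟨s, hs, hsu⟩⟩) w
        (Finset.mem_filter.2 ⟨hw, .inr ⟨s, hs, hsw⟩⟩) hsu hsw
    by_cases hT : ∀ x ∈ D, x ∉ B → ∀ y ∈ D, x ≠ y → G.Adj x y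
    · by_cases hcompl : ∀ x ∈ D, ∀ y ∈ D, x ≠ y → G.Adj x y
      · exact hlift b hbB ⟨hBD b hbB, fun u hu w hw _ _ huw => hcompl u hu w hw huw⟩
      · push Not at hcompl
        obtain ⟨x, hx, y, hy, hxy, hnxy⟩ := hcompl
        obtain ⟨s, hs, hsx, hxs⟩ := ih D hDS hx hy hxy hnxy
        refine hlift s ?_ hs
        by_contra hsB
        exact hxs (hT s hs.1 hsB x hx hsx).symm
    · push Not at hT
      obtain ⟨x, hx, hxB, y, hy, hxy, hnxy⟩ := hT
      obtain ⟨s, hs, hsx, hxs⟩ := ih D hDS hx hy hxy hnxy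
      refine hlift s ?_ hs
      by_contra hsB
      exact hxs (hclique x hx hxB s hs.1 hsB hsx.symm)

/-- Dirac's theorem: every nonempty finite set of vertices of a chordal graph has a simplicial
vertex. -/
theorem IsChordal.exists_isSimplicialIn {V : Type*} {G : SimpleGraph V} (hG : IsChordal G)
    {S : Finset V} (hS : S.Nonempty) : ∃ s, IsSimplicialIn G S s := by
  by_cases h : ∀ x ∈ S, ∀ y ∈ S, x ≠ y → G.Adj x y
  · obtain ⟨s, hs⟩ := hS
    exact ⟨s, hs, fun u hu w hw _ _ huw => h u hu w hw huw⟩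
  · push Not at h
    obtain ⟨x, hx, y, hy, hxy, hnxy⟩ := h
    obtain ⟨s, hs, -⟩ := hG.exists_isSimplicialIn_not_adj S hx hy hxy hnxy
    exact ⟨s, hs⟩

namespace Matrix.PosSemidef

variable {ι : Type*} {Q : Matrix ι ι ℝ}

theorem apply_comm_real (hQ : Q.PosSemidef) (i j : ι) : Q i j = Q j i := by
  simpa using hQ.isHermitian.apply j i

variable [Fintype ι]

theorem nonneg_real (hQ : Q.PosSemidef) (x : ι → ℝ) : 0 ≤ x ⬝ᵥ Q *ᵥ x := by
  simpa using hQ.dotProduct_mulVec_nonneg x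

variable [DecidableEq ι]

/-- The value of the quadratic form of `Q` at `x + c • e u`. -/
theorem dotProduct_mulVec_add_single (hQ : Q.PosSemidef) (x : ι → ℝ) (u : ι) (c : ℝ) :
    (x + Pi.single u c) ⬝ᵥ Q *ᵥ (x + Pi.single u c) =
      x ⬝ᵥ Q *ᵥ x + 2 * c * (Q *ᵥ x) u + c ^ 2 * Q u u := by
  have h : x ⬝ᵥ Q *ᵥ Pi.single u c = c * (Q *ᵥ x) u := by
    rw [Matrix.mulVec_single]
    simp only [Matrix.mulVec, dotProduct, Finset.mul_sum]
    refine Finset.sum_congr rfl fun i _ => ?_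
    simp [hQ.apply_comm_real u i]
    ring
  rw [Matrix.mulVec_add, add_dotProduct, dotProduct_add, dotProduct_add, h, single_dotProduct,
    single_dotProduct]
  simp
  ring

theorem apply_eq_zero_of_diag_eq_zero_s2 (hQ : Q.PosSemidef) {u : ι} (hu : Q u u = 0) (i : ι) :
    Q i u = 0 := by
  by_contra hne
  have h := hQ.nonneg_real (Pi.single i 1 + Pi.single u (-((Q i i + 1) / (2 * Q i u))))
  rw [hQ.dotProduct_mulVec_add_single, hu] at h
  simp only [Matrix.mulVec_single_one, single_one_dotProduct, Matrix.col_apply,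
    hQ.apply_comm_real u i] at h
  have hc : 2 * -((Q i i + 1) / (2 * Q i u)) * Q i u = -(Q i i + 1) := by field_simp
  rw [hc] at h
  linarith

/-- Eliminating the index `u` from a positive semidefinite matrix leaves a positive semidefinite
matrix (Schur complement). -/
theorem sub_vecMulVec_col (hQ : Q.PosSemidef) {u : ι} (hu : 0 < Q u u) :
    (Q - Matrix.vecMulVec (fun i => Q i u / √(Q u u)) fun i => Q i u / √(Q u u)).PosSemidef := by
  refine Matrix.PosSemidef.of_dotProduct_mulVec_nonneg
    (hQ.isHermitian.sub (by ext; simp [Matrix.vecMulVec_apply, mul_comm])) fun x => ?_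
  have hdot : (fun i => Q i u / √(Q u u)) ⬝ᵥ x = (Q *ᵥ x) u / √(Q u u) := by
    simp only [dotProduct, Matrix.mulVec, Finset.sum_div]
    exact Finset.sum_congr rfl fun i _ => by rw [hQ.apply_comm_real i u]; ring
  have h := hQ.nonneg_real (x + Pi.single u (-((Q *ᵥ x) u / Q u u)))
  rw [hQ.dotProduct_mulVec_add_single] at h
  rw [star_trivial, Matrix.sub_mulVec, dotProduct_sub, Matrix.vecMulVec_mulVec, hdot]
  have hx : x ⬝ᵥ (MulOpposite.op ((Q *ᵥ x) u / √(Q u u)) • fun i => Q i u / √(Q u u)) =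
      (Q *ᵥ x) u ^ 2 / Q u u := by
    rw [dotProduct_smul, dotProduct_comm, hdot, op_smul_eq_mul, div_mul_div_comm,
      Real.mul_self_sqrt hu.le, sq]
  rw [hx]
  have hc : (-((Q *ᵥ x) u / Q u u)) ^ 2 * Q u u = (Q *ᵥ x) u ^ 2 / Q u u := by field_simp
  rw [hc] at h
  linear_combination h

end Matrix.PosSemidef

/-- A positive semidefinite matrix whose sparsity pattern is a chordal graph is a sum of rank one
positive semidefinite matrices, each supported on a clique. -/
theorem IsChordal.exists_sum_vecMulVec {ι : Type*} [Fintype ι] {G : SimpleGraph ι}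
    (hG : IsChordal G) (S : Finset ι) {Q : Matrix ι ι ℝ} (hQ : Q.PosSemidef)
    (hQG : ∀ i j, i ≠ j → ¬ G.Adj i j → Q i j = 0) (hQS : ∀ i j, i ∉ S → Q i j = 0) :
    ∃ (N : ℕ) (v : Fin N → ι → ℝ), Q = ∑ l, Matrix.vecMulVec (v l) (v l) ∧
      ∀ l, G.IsClique (Function.support (v l)) := by
  classical
  induction S using Finset.strongInduction generalizing Q with
  | H S ih =>
    rcases S.eq_empty_or_nonempty with rfl | hS
    · exact ⟨0, Fin.elim0, by ext i j; simpa using hQS i j (by simp), fun l => l.elim0⟩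
    obtain ⟨u, huS, hu⟩ := hG.exists_isSimplicialIn hS
    have hlt := Finset.erase_ssubset huS
    rcases (hQ.diag_nonneg (i := u)).eq_or_lt with h0 | hpos
    · refine ih _ hlt hQ hQG fun i j hi => ?_
      rw [Finset.mem_erase, not_and_or, not_not] at hi
      rcases hi with rfl | hi
      · rw [hQ.apply_comm_real, hQ.apply_eq_zero_of_diag_eq_zero_s2 h0.symm]
      · exact hQS i j hi
    · let v : ι → ℝ := fun i => Q i u / √(Q u u)
      have hvsupp : ∀ i, v i ≠ 0 → i ∈ S ∧ (i ≠ u → G.Adj u i) := by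
        intro i hi
        have hi' : Q i u ≠ 0 := fun h => hi (by simp [v, h])
        refine ⟨by_contra fun h => hi' (hQS i u h), fun hne => ?_⟩
        by_contra h
        exact hi' (hQG i u hne fun h' => h h'.symm)
      have hclique : G.IsClique (Function.support v) := by
        intro i hi j hj hij
        obtain ⟨hiS, hiu⟩ := hvsupp i hi
        obtain ⟨hjS, hju⟩ := hvsupp j hj
        by_cases h : i = u
        · subst h
          exact hju hij.symm
        · by_cases h' : j = u
          · subst h'
            exact (hiu h).symm
          · exact hu i hiS j hjS (hiu h) (hju h') hij
      obtain ⟨N, w, hw, hwc⟩ := ih _ hlt (hQ.sub_vecMulVec_col hpos) (fun i j hij hadj => by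
          have : v i * v j = 0 := by
            by_contra h
            exact hadj (hclique (left_ne_zero_of_mul h) (right_ne_zero_of_mul h) hij)
          rw [Matrix.sub_apply, Matrix.vecMulVec_apply, hQG i j hij hadj, zero_sub, neg_eq_zero]
          exact this) (fun i j hi => by
          rw [Finset.mem_erase, not_and_or, not_not] at hi
          simp only [Matrix.sub_apply, Matrix.vecMulVec_apply]
          rcases hi with rfl | hi
          · rw [div_mul_div_comm, Real.mul_self_sqrt hpos.le, mul_div_cancel_left₀ _ hpos.ne',
              hQ.apply_comm_real, sub_self]
          · simp [hQS i _ hi])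
      refine ⟨N + 1, Fin.cons v w, ?_, fun l => ?_⟩
      · rw [Fin.sum_univ_succ]
        simp only [Fin.cons_zero, Fin.cons_succ]
        rw [← hw]
        exact (add_sub_cancel _ _).symm
      · refine Fin.cases ?_ (fun l => ?_) l
        · simpa using hclique
        · simpa using hwc l

/-- The polynomial with coefficient vector `v` with respect to the monomials `x ^ ω i`. -/
def monomialCombination {σ ι : Type*} [Fintype ι] (ω : ι → σ →₀ ℕ) (v : ι → ℝ) :
    MvPolynomial σ ℝ :=
  ∑ i, MvPolynomial.monomial (ω i) (v i)

section

variable {σ ι : Type*} [Fintype ι] (ω : ι → σ →₀ ℕ)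

theorem coeff_monomialCombination [DecidableEq σ] (v : ι → ℝ) (β : σ →₀ ℕ) :
    (monomialCombination ω v).coeff β = ∑ i, if ω i = β then v i else 0 := by
  simp [monomialCombination, MvPolynomial.coeff_sum, MvPolynomial.coeff_monomial]

theorem exists_of_mem_support_monomialCombination {v : ι → ℝ} {β : σ →₀ ℕ}
    (hβ : β ∈ (monomialCombination ω v).support) : ∃ i, v i ≠ 0 ∧ ω i = β := by
  classical
  rw [MvPolynomial.mem_support_iff, coeff_monomialCombination] at hβ
  obtain ⟨i, -, hi⟩ := Finset.exists_ne_zero_of_sum_ne_zero hβ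
  by_cases h : ω i = β
  · exact ⟨i, by simpa [h] using hi, h⟩
  · simp [h] at hi

theorem monomialCombination_coeff {ω : ι → σ →₀ ℕ} (hω : Function.Injective ω)
    {p : MvPolynomial σ ℝ} (hp : ∀ β ∈ p.support, ∃ i, ω i = β) :
    monomialCombination ω (fun i => p.coeff (ω i)) = p := by
  classical
  ext β
  rw [coeff_monomialCombination]
  by_cases hβ : ∃ i, ω i = β
  · obtain ⟨i, rfl⟩ := hβ
    simp [hω.eq_iff]
  · have h0 : p.coeff β = 0 := by
      by_contra h
      exact hβ (hp β (MvPolynomial.mem_support_iff.2 h))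
    rw [h0]
    exact Finset.sum_eq_zero fun i _ => if_neg fun h => hβ ⟨i, h⟩

theorem monomialCombination_sq (v : ι → ℝ) :
    monomialCombination ω v ^ 2 = ∑ i, ∑ j, Matrix.vecMulVec v v i j •
      MvPolynomial.monomial (ω i + ω j) (1 : ℝ) := by
  simp [monomialCombination, sq, Finset.sum_mul_sum, MvPolynomial.monomial_mul,
    MvPolynomial.smul_monomial, Matrix.vecMulVec_apply]

theorem sum_monomialCombination_sq {κ : Type*} (s : Finset κ) (v : κ → ι → ℝ) :
    ∑ l ∈ s, monomialCombination ω (v l) ^ 2 =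
      ∑ i, ∑ j, (∑ l ∈ s, Matrix.vecMulVec (v l) (v l)) i j •
        MvPolynomial.monomial (ω i + ω j) (1 : ℝ) := by
  simp only [monomialCombination_sq, Matrix.sum_apply, Finset.sum_smul]
  rw [Finset.sum_comm]
  exact Finset.sum_congr rfl fun i _ => Finset.sum_comm

end

/-- **Sparse SOS decomposition via cross sparsity patterns.**
Let `𝒜 ⊆ ℕ^n` be finite, let `ℬ = {ω 1, ..., ω r}` be the support set of a monomial basis,
let `G` be the cross sparsity pattern graph (edges `{i,j}`, `i ≠ j`, whenever
`ω i + ω j ∈ 𝒜 ∪ 2ℬ`), let `Gext` be a chordal extension of `G` whose maximal cliques are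
exactly `C 1, ..., C t`, and set `ℬ_k = {ω i : i ∈ C k}`.  A polynomial `f ∈ ℝ[𝒜]` lies in
`Σ̃(𝒜)`, i.e. admits a Gram matrix `Q ∈ S₊^r(Ẽ_𝒜, 0)` with `f = (x^ℬ)ᵀ Q x^ℬ`, if and only
if there exist polynomials `g k ∈ ℝ[ℬ_k]²` (sums of squares of polynomials supported in
`ℬ_k`) with `f = ∑ k, g k`. -/
theorem sparse_sos_decomposition {n r t : ℕ}
    (𝒜 : Finset (Fin n →₀ ℕ)) (ω : Fin r → (Fin n →₀ ℕ)) (hω : Function.Injective ω)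
    (G Gext : SimpleGraph (Fin r))
    (hG : ∀ i j, G.Adj i j ↔ i ≠ j ∧ (ω i + ω j ∈ 𝒜 ∨ ∃ k, ω i + ω j = ω k + ω k))
    (hle : G ≤ Gext) (hchordal : IsChordal Gext)
    (C : Fin t → Finset (Fin r))
    (hmax : ∀ s : Finset (Fin r),
      (Gext.IsClique ↑s ∧ ∀ s' : Finset (Fin r), Gext.IsClique ↑s' → s ⊆ s' → s' = s) ↔
        ∃ k, C k = s)
    (f : MvPolynomial (Fin n) ℝ) (hf : ↑f.support ⊆ (𝒜 : Set (Fin n →₀ ℕ))) :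
    (∃ Q : Matrix (Fin r) (Fin r) ℝ, Q.PosSemidef ∧
        (∀ i j, i ≠ j → ¬ Gext.Adj i j → Q i j = 0) ∧
        f = ∑ i, ∑ j, Q i j • MvPolynomial.monomial (ω i + ω j) (1 : ℝ)) ↔
      (∃ g : Fin t → MvPolynomial (Fin n) ℝ,
        f = ∑ k, g k ∧
        ∀ k, ∃ (m : ℕ) (h : Fin m → MvPolynomial (Fin n) ℝ),
          g k = ∑ l, (h l) ^ 2 ∧
          ∀ l, ↑(h l).support ⊆ {β : Fin n →₀ ℕ | ∃ i ∈ C k, ω i = β}) := by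
  classical
  constructor
  · rintro ⟨Q, hQ, hQG, rfl⟩
    obtain ⟨N, v, rfl, hv⟩ :=
      hchordal.exists_sum_vecMulVec Finset.univ hQ hQG fun i _ hi => absurd (Finset.mem_univ i) hi
    have hκ : ∀ l, ∃ k, ∀ i, v l i ≠ 0 → i ∈ C k := by
      intro l
      obtain ⟨s, hs, hsmax⟩ := Finite.exists_le_maximal
        (p := fun s : Finset (Fin r) => Gext.IsClique (s : Set (Fin r)))
        (a := Finset.univ.filter fun i => v l i ≠ 0)
        (by simpa [Function.support] using hv l)
      obtain ⟨k, rfl⟩ := (hmax s).1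
        ⟨hsmax.prop, fun s' hs' hle => (hsmax.eq_of_le hs' hle).symm⟩
      exact ⟨k, fun i hi => hs (by simpa using hi)⟩
    choose κ hκ using hκ
    refine ⟨fun k => ∑ l, (if κ l = k then monomialCombination ω (v l) else 0) ^ 2, ?_,
      fun k => ⟨N, _, rfl, fun l β hβ => ?_⟩⟩
    · rw [← sum_monomialCombination_sq, Finset.sum_comm]
      simp [ite_pow]
    · split_ifs at hβ with h
      · obtain ⟨i, hi, hiβ⟩ := exists_of_mem_support_monomialCombination ω hβ
        exact ⟨i, h ▸ hκ l i hi, hiβ⟩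
      · simp at hβ
  · rintro ⟨g, rfl, hg⟩
    choose m h hgh hsupp using hg
    let v : (Σ k, Fin (m k)) → Fin r → ℝ := fun l i => (h l.1 l.2).coeff (ω i)
    have hv : ∀ l i, v l i ≠ 0 → i ∈ C l.1 := by
      intro l i hi
      obtain ⟨j, hj, hji⟩ := hsupp l.1 l.2 (MvPolynomial.mem_support_iff.2 hi)
      exact hω hji ▸ hj
    refine ⟨∑ l, Matrix.vecMulVec (v l) (v l), ?_, fun i j hij hadj => ?_, ?_⟩
    · exact Matrix.posSemidef_sum _ fun l _ => by
        simpa using Matrix.posSemidef_vecMulVec_self_star (v l)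
    · rw [Matrix.sum_apply]
      refine Finset.sum_eq_zero fun l _ => ?_
      rw [Matrix.vecMulVec_apply]
      by_contra hne
      exact hadj (((hmax _).2 ⟨l.1, rfl⟩).1 (hv l i (left_ne_zero_of_mul hne))
        (hv l j (right_ne_zero_of_mul hne)) hij)
    · rw [← sum_monomialCombination_sq, Fintype.sum_sigma]
      refine Finset.sum_congr rfl fun k _ => ?_
      rw [hgh]
      refine Finset.sum_congr rfl fun l _ => ?_
      rw [monomialCombination_coeff hω fun β hβ => ?_]
      obtain ⟨i, -, hi⟩ := hsupp k l hβ
      exact ⟨i, hi⟩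
end
end

section
/- Let f ∈ ℝ[x_1,...,x_n] with supp(f) = 𝒜, let ℬ = {ω_1,...,ω_r} be the support set of a monomial basis for f, and let r_1,...,r_s ∈ {0,1}^n be the sign-symmetries of f. If f admits a positive semidefinite Gram matrix Q with f = (x^ℬ)^T Q x^ℬ, then f admits a positive semidefinite Gram matrix Q' with f = (x^ℬ)^T Q' x^ℬ such that Q'_{ij} = 0 whenever there exists a sign-symmetry r of f with r^T ω_i ≢ r^T ω_j (mod 2). Consequently, f is a sum of SOS polynomials, one supported on each equivalence class of ℬ under the relation ω_i ~ ω_j ⟺ r^T ω_i ≡ r^T ω_j (mod 2) for all sign-symmetries r. -/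
open scoped BigOperators Matrix

noncomputable section

/-- A sign-symmetry of `f` is a vector `s ∈ {0,1}^n` (encoded with entries in `ZMod 2`)
such that `sᵀ α ≡ 0 (mod 2)` for every exponent `α` in the support of `f`. -/
def IsSignSymmetry {n : ℕ} (f : MvPolynomial (Fin n) ℝ) (s : Fin n → ZMod 2) : Prop :=
  ∀ α ∈ f.support, ∑ i, s i * (α i : ZMod 2) = 0

/-- The inner product `sᵀ ω` modulo 2. -/
def dotMod2 {n : ℕ} (s : Fin n → ZMod 2) (ω : Fin n →₀ ℕ) : ZMod 2 :=
  ∑ i, s i * (ω i : ZMod 2)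

theorem dotMod2_add_eq_zero_iff {n : ℕ} (s : Fin n → ZMod 2) (a b : Fin n →₀ ℕ) :
    dotMod2 s (a + b) = 0 ↔ dotMod2 s a = dotMod2 s b := by
  have h : dotMod2 s (a + b) = dotMod2 s a + dotMod2 s b := by
    simp [dotMod2, mul_add, Finset.sum_add_distrib]
  rw [h]
  exact CharTwo.add_eq_zero

/-- Gram entries whose two exponents are separated by a sign-symmetry may be set to zero. -/
theorem eq_sum_gram_of_signSymmetry {n r : ℕ} {f : MvPolynomial (Fin n) ℝ}
    {ω : Fin r → (Fin n →₀ ℕ)} {Q Q' : Matrix (Fin r) (Fin r) ℝ}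
    (hf : f = ∑ i, ∑ j, Q i j • MvPolynomial.monomial (ω i + ω j) (1 : ℝ))
    (heq : ∀ i j, (∀ s, IsSignSymmetry f s → dotMod2 s (ω i) = dotMod2 s (ω j)) →
      Q' i j = Q i j)
    (hzero : ∀ i j, (∃ s, IsSignSymmetry f s ∧ dotMod2 s (ω i) ≠ dotMod2 s (ω j)) →
      Q' i j = 0) :
    f = ∑ i, ∑ j, Q' i j • MvPolynomial.monomial (ω i + ω j) (1 : ℝ) := by
  ext α
  by_cases hα : ∀ s, IsSignSymmetry f s → dotMod2 s α = 0
  · conv_lhs => rw [hf]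
    simp only [MvPolynomial.coeff_sum, MvPolynomial.coeff_smul, MvPolynomial.coeff_monomial]
    refine Finset.sum_congr rfl fun i _ => Finset.sum_congr rfl fun j _ => ?_
    split_ifs with h
    · rw [heq i j fun s hs => (dotMod2_add_eq_zero_iff s _ _).1 (h ▸ hα s hs)]
    · simp
  · push Not at hα
    obtain ⟨s, hs, hsα⟩ := hα
    rw [MvPolynomial.notMem_support_iff.1 fun h => hsα (hs α h)]
    simp only [MvPolynomial.coeff_sum, MvPolynomial.coeff_smul, MvPolynomial.coeff_monomial]
    refine (Finset.sum_eq_zero fun i _ => Finset.sum_eq_zero fun j _ => ?_).symm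
    split_ifs with h
    · rw [hzero i j ⟨s, hs, fun h' => hsα (h ▸ (dotMod2_add_eq_zero_iff s _ _).2 h')⟩, zero_smul]
    · simp

open scoped MatrixOrder Matrix.Norms.L2Operator in
/-- Restricting a positive semidefinite matrix to the diagonal blocks given by the fibres of `κ`
yields a Gram matrix of vectors each supported on a single fibre. -/
theorem exists_blockwise_factor {ι : Type*} [Fintype ι] [DecidableEq ι] {Q : Matrix ι ι ℝ}
    (hQ : Q.PosSemidef) (κ : ι → ι) :
    ∃ C : Matrix (ι × ι) ι ℝ, (∀ c l i, κ i ≠ c → C (c, l) i = 0) ∧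
      ∀ i j, (Cᴴ * C) i j = if κ i = κ j then Q i j else 0 := by
  obtain ⟨B, rfl⟩ := CStarAlgebra.nonneg_iff_eq_star_mul_self.1 hQ.nonneg
  refine ⟨Matrix.of fun p i => if κ i = p.1 then B p.2 i else 0, ?_, fun i j => ?_⟩
  · intro c l i h
    simp [h]
  · simp [Matrix.mul_apply, Fintype.sum_prod_type, Matrix.star_eq_conjTranspose, eq_comm]

/-- The polynomial of the Gram matrix `Cᴴ * C` is a sum of squares, one for each row of `C`. -/
theorem sum_gram_conjTranspose_mul_self {σ ι m : Type*} [Fintype ι] [Fintype m]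
    (ω : ι → (σ →₀ ℕ)) (C : Matrix m ι ℝ) :
    ∑ i, ∑ j, (Cᴴ * C) i j • MvPolynomial.monomial (ω i + ω j) (1 : ℝ) =
      ∑ p, (∑ i, MvPolynomial.monomial (ω i) (C p i)) ^ 2 := by
  simp only [sq, Finset.sum_mul_sum, MvPolynomial.monomial_mul, Matrix.mul_apply,
    Matrix.conjTranspose_apply, star_trivial, MvPolynomial.smul_monomial, smul_eq_mul, mul_one,
    map_sum]
  exact (Finset.sum_congr rfl fun i _ => Finset.sum_comm).trans Finset.sum_comm

/-- **Block-diagonalization by sign-symmetries (Löfberg).**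
Let `f ∈ ℝ[x]` with monomial basis support set `ℬ = {ω 1, ..., ω r}`.  If `f` admits a
positive semidefinite Gram matrix `Q` with `f = (x^ℬ)ᵀ Q x^ℬ`, then `f` admits a positive
semidefinite Gram matrix `Q'` with `Q' i j = 0` whenever some sign-symmetry `s` of `f`
has `sᵀ ω_i ≢ sᵀ ω_j (mod 2)`.  Consequently `f` is a sum of SOS polynomials, one
supported on each equivalence class of `ℬ` under
`ω_i ~ ω_j ↔ ∀ sign-symmetry s, sᵀ ω_i ≡ sᵀ ω_j (mod 2)`. -/
theorem sign_symmetry_block_diagonalization {n r : ℕ} (f : MvPolynomial (Fin n) ℝ)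
    (ω : Fin r → (Fin n →₀ ℕ)) (hω : Function.Injective ω)
    (Q : Matrix (Fin r) (Fin r) ℝ) (hQ : Q.PosSemidef)
    (hf : f = ∑ i, ∑ j, Q i j • MvPolynomial.monomial (ω i + ω j) (1 : ℝ)) :
    (∃ Q' : Matrix (Fin r) (Fin r) ℝ, Q'.PosSemidef ∧
      f = ∑ i, ∑ j, Q' i j • MvPolynomial.monomial (ω i + ω j) (1 : ℝ) ∧
      ∀ i j, (∃ s, IsSignSymmetry f s ∧ dotMod2 s (ω i) ≠ dotMod2 s (ω j)) →
        Q' i j = 0) ∧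
    (∃ g : Fin r → MvPolynomial (Fin n) ℝ, f = ∑ i, g i ∧
      ∀ i, ∃ (m : ℕ) (h : Fin m → MvPolynomial (Fin n) ℝ),
        g i = ∑ l, (h l) ^ 2 ∧
        ∀ l, ↑(h l).support ⊆
          {β : Fin n →₀ ℕ | ∃ j, (∀ s, IsSignSymmetry f s →
            dotMod2 s (ω j) = dotMod2 s (ω i)) ∧ ω j = β}) := by
  classical
  let S : Setoid (Fin r) :=
    { r := fun i j => ∀ s, IsSignSymmetry f s → dotMod2 s (ω i) = dotMod2 s (ω j)
      iseqv := ⟨fun _ _ _ => rfl, fun h s hs => (h s hs).symm,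
        fun h h' s hs => (h s hs).trans (h' s hs)⟩ }
  let κ : Fin r → Fin r := fun i => (Quotient.mk S i).out
  have hκ (i j : Fin r) :
      κ i = κ j ↔ ∀ s, IsSignSymmetry f s → dotMod2 s (ω i) = dotMod2 s (ω j) :=
    Quotient.out_inj.trans Quotient.eq
  have hκ_rel (i : Fin r) (s) (hs : IsSignSymmetry f s) :
      dotMod2 s (ω (κ i)) = dotMod2 s (ω i) :=
    Quotient.mk_out (s := S) i s hs
  obtain ⟨C, hC, hCQ⟩ := exists_blockwise_factor hQ κ
  have hzero (i j : Fin r)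
      (h : ∃ s, IsSignSymmetry f s ∧ dotMod2 s (ω i) ≠ dotMod2 s (ω j)) : (Cᴴ * C) i j = 0 := by
    obtain ⟨s, hs, hne⟩ := h
    rw [hCQ, if_neg fun h => hne ((hκ i j).1 h s hs)]
  have hgram : f = ∑ i, ∑ j, (Cᴴ * C) i j • MvPolynomial.monomial (ω i + ω j) (1 : ℝ) :=
    eq_sum_gram_of_signSymmetry hf (fun i j h => by rw [hCQ, if_pos ((hκ i j).2 h)]) hzero
  refine ⟨⟨Cᴴ * C, Matrix.posSemidef_conjTranspose_mul_self C, hgram, hzero⟩,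
    fun c => ∑ l, (∑ i, MvPolynomial.monomial (ω i) (C (c, l) i)) ^ 2, ?_,
    fun c => ⟨r, fun l => ∑ i, MvPolynomial.monomial (ω i) (C (c, l) i), rfl, ?_⟩⟩
  · exact hgram.trans ((sum_gram_conjTranspose_mul_self ω C).trans (Fintype.sum_prod_type _))
  · intro l β hβ
    obtain ⟨i, -, hi⟩ := Finset.mem_biUnion.1 (MvPolynomial.support_sum hβ)
    rw [MvPolynomial.support_monomial] at hi
    split_ifs at hi with h
    · simp at hi
    · have hic : κ i = c := not_imp_comm.1 (hC c l i) h
      exact ⟨i, fun s hs => hic ▸ (hκ_rel i s hs).symm, (Finset.mem_singleton.1 hi).symm⟩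
end
end

section
/- Let f ∈ ℝ[x_1,...,x_n] with supp(f) = 𝒜 and let ℬ = {ω_1,...,ω_r} ⊆ ℕ^n be the support set of a monomial basis. If ω_i + ω_j ∈ 𝒜 ∪ 2ℬ, where 2ℬ = {2ω_1,...,2ω_r}, then for every sign-symmetry r of f one has r^T ω_i ≡ r^T ω_j (mod 2). -/
open scoped BigOperators

noncomputable section

theorem dotMod2_add {n : ℕ} (s : Fin n → ZMod 2) (ω ω' : Fin n →₀ ℕ) :
    dotMod2 s (ω + ω') = dotMod2 s ω + dotMod2 s ω' := by
  simp [dotMod2, mul_add, Finset.sum_add_distrib]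

/-- Let `f ∈ ℝ[x]` with `supp f = 𝒜` and `ℬ = {ω 1, ..., ω r}` the support set of a
monomial basis.  If `ω i + ω j ∈ 𝒜 ∪ 2ℬ` (where `2ℬ = {2 ω k}`), then for every
sign-symmetry `s` of `f` one has `sᵀ ω_i ≡ sᵀ ω_j (mod 2)`. -/
theorem cross_edge_sign_symmetry {n r : ℕ} (f : MvPolynomial (Fin n) ℝ)
    (𝒜 : Finset (Fin n →₀ ℕ)) (h𝒜 : f.support = 𝒜)
    (ω : Fin r → (Fin n →₀ ℕ)) (i j : Fin r)
    (hij : ω i + ω j ∈ 𝒜 ∨ ∃ k, ω i + ω j = ω k + ω k)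
    (s : Fin n → ZMod 2) (hs : IsSignSymmetry f s) :
    dotMod2 s (ω i) = dotMod2 s (ω j) := by
  rw [← CharTwo.add_eq_zero, ← dotMod2_add]
  rcases hij with hmem | ⟨k, hk⟩
  · exact hs _ (h𝒜 ▸ hmem)
  · rw [hk, dotMod2_add, CharTwo.add_self_eq_zero]
end
end

section
/- Let 𝒜 ⊆ ℕ^n be finite with Σ_{i=1}^n α_i ≤ 2 for every α ∈ 𝒜 (the quadratic case), and let ℬ = {0, e_1,...,e_n} be the support set of the monomial basis (1, x_1,...,x_n). Then Σ(𝒜) = Σ̃(𝒜); i.e., every polynomial f with supp(f) ⊆ 𝒜 that admits a positive semidefinite Gram matrix Q with f = (x^ℬ)^T Q x^ℬ also admits a positive semidefinite Gram matrix lying in S_+^{n+1}(Ẽ_𝒜, 0), where G̃(V_𝒜, Ẽ_𝒜) is any chordal extension of the cross sparsity pattern graph G(V_𝒜, E_𝒜). -/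
open scoped BigOperators

noncomputable section

/-- The exponent vectors of the monomial basis `(1, x_1, ..., x_n)ᵀ`, i.e.
`ℬ = {0, e_1, ..., e_n}`: index `0` corresponds to the constant monomial `1` and
index `i.succ` to `x_i`. -/
def quadBasis (n : ℕ) : Fin (n + 1) → (Fin n →₀ ℕ) :=
  Fin.cons 0 fun i => Finsupp.single i 1

theorem quadBasis_apply {n : ℕ} (i : Fin (n + 1)) (t : Fin n) :
    quadBasis n i t = if i = t.succ then 1 else 0 := by
  refine Fin.cases ?_ (fun i => ?_) i
  · simp [quadBasis, (Fin.succ_ne_zero t).symm]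
  · simp [quadBasis, Finsupp.single_apply]

/-- A sum of two elements of `ℬ` determines the unordered pair of summands. -/
theorem quadBasis_add_eq_iff {n : ℕ} (a b i j : Fin (n + 1)) :
    quadBasis n a + quadBasis n b = quadBasis n i + quadBasis n j ↔
      (a = i ∧ b = j) ∨ (a = j ∧ b = i) := by
  constructor
  · intro h
    have key : ∀ s : Fin (n + 1), s ≠ 0 →
        (if a = s then 1 else 0) + (if b = s then 1 else 0) =
          (if i = s then 1 else 0) + (if j = s then 1 else 0) := by
      intro s hs
      obtain ⟨t, rfl⟩ := Fin.exists_succ_eq.mpr hs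
      simpa [quadBasis_apply] using DFunLike.congr_fun h t
    have ha := key a
    have hb := key b
    have hi := key i
    have hj := key j
    grind
  · rintro (⟨rfl, rfl⟩ | ⟨rfl, rfl⟩)
    · rfl
    · exact add_comm _ _

theorem coeff_gram_quadBasis {n : ℕ} (Q : Matrix (Fin (n + 1)) (Fin (n + 1)) ℝ)
    {i j : Fin (n + 1)} (hij : i ≠ j) :
    MvPolynomial.coeff (quadBasis n i + quadBasis n j)
      (∑ a, ∑ b, Q a b • MvPolynomial.monomial (quadBasis n a + quadBasis n b) (1 : ℝ)) =
      Q i j + Q j i := by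
  have hterm : ∀ a b : Fin (n + 1),
      Q a b * (if (a = i ∧ b = j) ∨ (a = j ∧ b = i) then (1 : ℝ) else 0) =
        (if a = i then if b = j then Q a b else 0 else 0) +
          (if a = j then if b = i then Q a b else 0 else 0) := by
    intro a b
    grind
  simp only [MvPolynomial.coeff_sum, MvPolynomial.coeff_smul, MvPolynomial.coeff_monomial,
    quadBasis_add_eq_iff, smul_eq_mul, hterm, Finset.sum_add_distrib]
  simp [Finset.sum_ite_irrel]

/-- **In the quadratic case, `Σ(𝒜) = Σ̃(𝒜)`.**
Let `𝒜 ⊆ ℕ^n` be finite with `∑ i, α i ≤ 2` for every `α ∈ 𝒜`, let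
`ℬ = {0, e_1, ..., e_n}` be the support set of the monomial basis `(1, x_1, ..., x_n)`,
let `G` be the cross sparsity pattern graph of `𝒜` and let `Gext` be any chordal
extension of it.  Then the set of polynomials supported in `𝒜` admitting a positive
semidefinite Gram matrix equals the set of polynomials supported in `𝒜` admitting a
positive semidefinite Gram matrix in `S₊^{n+1}(Ẽ_𝒜, 0)`. -/
theorem quadratic_sigma_eq_sigma_tilde {n : ℕ} (𝒜 : Finset (Fin n →₀ ℕ))
    (h𝒜 : ∀ α ∈ 𝒜, (∑ i, α i) ≤ 2)
    (G Gext : SimpleGraph (Fin (n + 1)))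
    (hG : ∀ i j, G.Adj i j ↔ i ≠ j ∧
      (quadBasis n i + quadBasis n j ∈ 𝒜 ∨
        ∃ k, quadBasis n i + quadBasis n j = quadBasis n k + quadBasis n k))
    (hle : G ≤ Gext) (hchordal : IsChordal Gext) :
    {f : MvPolynomial (Fin n) ℝ | ↑f.support ⊆ (𝒜 : Set (Fin n →₀ ℕ)) ∧
        ∃ Q : Matrix (Fin (n + 1)) (Fin (n + 1)) ℝ, Q.PosSemidef ∧
          f = ∑ i, ∑ j, Q i j •
            MvPolynomial.monomial (quadBasis n i + quadBasis n j) (1 : ℝ)} =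
      {f : MvPolynomial (Fin n) ℝ | ↑f.support ⊆ (𝒜 : Set (Fin n →₀ ℕ)) ∧
        ∃ Q : Matrix (Fin (n + 1)) (Fin (n + 1)) ℝ, Q.PosSemidef ∧
          (∀ i j, i ≠ j → ¬ Gext.Adj i j → Q i j = 0) ∧
          f = ∑ i, ∑ j, Q i j •
            MvPolynomial.monomial (quadBasis n i + quadBasis n j) (1 : ℝ)} := by
  ext f
  constructor
  · rintro ⟨hf, Q, hQ, hfQ⟩
    refine ⟨hf, Q, hQ, fun i j hij hadj => ?_, hfQ⟩
    have hnot : quadBasis n i + quadBasis n j ∉ 𝒜 := fun hmem =>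
      hadj (hle ((hG i j).mpr ⟨hij, Or.inl hmem⟩))
    have hcoeff : MvPolynomial.coeff (quadBasis n i + quadBasis n j) f = 0 :=
      MvPolynomial.notMem_support_iff.mp fun hmem => hnot (hf hmem)
    rw [hfQ, coeff_gram_quadBasis Q hij] at hcoeff
    have hsymm : Q j i = Q i j := by simpa using hQ.isHermitian.apply i j
    linarith
  · rintro ⟨hf, Q, hQ, -, hfQ⟩
    exact ⟨hf, Q, hQ, hfQ⟩
end
end

section
/- If f ∈ ℝ[x_1,...,x_n] is nonnegative on ℝ^n, then every vertex of the Newton polytope of f is an even vector; that is, V(New(f)) = V(supp(f)) ⊆ (2ℕ)^n. -/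
open scoped BigOperators

noncomputable section

/-- The embedding of an exponent vector `α ∈ ℕ^n` into `ℝ^n`. -/
def expVec {n : ℕ} (α : Fin n →₀ ℕ) : Fin n → ℝ := fun i => (α i : ℝ)

theorem expVec_injective {n : ℕ} : Function.Injective (expVec (n := n)) := fun α β h => by
  ext i
  exact Nat.cast_injective (R := ℝ) (congrFun h i)

/-- An extreme point of the convex hull of a finite set strictly maximizes some linear
functional over that set. -/
theorem exists_forall_lt_of_mem_extremePoints_convexHull {E : Type*} [AddCommGroup E]
    [TopologicalSpace E] [IsTopologicalAddGroup E] [T2Space E] [Module ℝ E] [ContinuousSMul ℝ E]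
    [LocallyConvexSpace ℝ E] {s : Set E} (hs : s.Finite) {v : E}
    (hv : v ∈ (convexHull ℝ s).extremePoints ℝ) :
    ∃ l : StrongDual ℝ E, ∀ a ∈ s, a ≠ v → l a < l v := by
  rw [(convex_convexHull ℝ s).mem_extremePoints_iff_mem_sdiff_convexHull_sdiff] at hv
  have hv' : v ∉ convexHull ℝ (s \ {v}) := fun h =>
    hv.2 (convexHull_mono (Set.sdiff_subset_sdiff_left (subset_convexHull ℝ s)) h)
  obtain ⟨l, u, hlt, hu⟩ := geometric_hahn_banach_closed_point (convex_convexHull ℝ (s \ {v}))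
    (hs.sdiff.isClosed_convexHull ℝ) hv'
  exact ⟨l, fun a ha hav => (hlt a (subset_convexHull ℝ _ ⟨ha, hav⟩)).trans hu⟩

/-- Along a curve `t ↦ (ε i * exp (t * w i))`, the monomial whose exponent uniquely maximizes
the weight `w` dominates. -/
theorem tendsto_exp_mul_eval {n : ℕ} {f : MvPolynomial (Fin n) ℝ} {α : Fin n →₀ ℕ}
    (hα : α ∈ f.support) (w ε : Fin n → ℝ)
    (hw : ∀ β ∈ f.support, β ≠ α → ∑ i, expVec β i * w i < ∑ i, expVec α i * w i) :
    Filter.Tendsto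
      (fun t : ℝ => Real.exp (-(t * ∑ i, expVec α i * w i)) *
        MvPolynomial.eval (fun i => ε i * Real.exp (t * w i)) f)
      Filter.atTop (nhds (f.coeff α * ∏ i, ε i ^ α i)) := by
  have hterm : ∀ (t : ℝ) (β : Fin n →₀ ℕ),
      Real.exp (-(t * ∑ i, expVec α i * w i)) *
        (f.coeff β * ∏ i, (ε i * Real.exp (t * w i)) ^ β i) =
      (f.coeff β * ∏ i, ε i ^ β i) *
        Real.exp ((∑ i, expVec β i * w i - ∑ i, expVec α i * w i) * t) := by
    intro t β
    have hexp : ∏ i, Real.exp (t * w i) ^ β i = Real.exp (t * ∑ i, expVec β i * w i) := by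
      rw [Finset.mul_sum, Real.exp_sum]
      refine Finset.prod_congr rfl fun i _ => ?_
      rw [← Real.exp_nat_mul, expVec]
      ring_nf
    simp_rw [mul_pow, Finset.prod_mul_distrib, hexp]
    rw [sub_mul, sub_eq_add_neg, Real.exp_add]
    ring_nf
  simp_rw [MvPolynomial.eval_eq', Finset.mul_sum f.support, hterm]
  rw [← Finset.sum_ite_eq_of_mem' f.support α (fun β => f.coeff β * ∏ i, ε i ^ β i) hα]
  refine tendsto_finsetSum _ fun β hβ => ?_
  split_ifs with h
  · simp [h]
  · have hlim := Real.tendsto_exp_atBot.comp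
      (Filter.tendsto_id.const_mul_atTop_of_neg (sub_neg.2 (hw β hβ h)))
    simpa using hlim.const_mul (f.coeff β * ∏ i, ε i ^ β i)

/-- **Reznick.** If `f ∈ ℝ[x_1,...,x_n]` is nonnegative on `ℝ^n`, then every vertex
(extreme point) of its Newton polytope `New(f) = conv(supp f)` is an even vector, i.e.
all its coordinates are even natural numbers: `V(New(f)) ⊆ (2ℕ)^n`. -/
theorem newton_polytope_vertices_even {n : ℕ} (f : MvPolynomial (Fin n) ℝ)
    (hf : ∀ x : Fin n → ℝ, 0 ≤ MvPolynomial.eval x f) :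
    ∀ v ∈ Set.extremePoints ℝ (convexHull ℝ (expVec '' (f.support : Set (Fin n →₀ ℕ)))),
      ∀ i, ∃ m : ℕ, v i = 2 * m := by
  intro v hv i
  obtain ⟨α, hα, rfl⟩ := extremePoints_convexHull_subset hv
  obtain ⟨l, hl⟩ := exists_forall_lt_of_mem_extremePoints_convexHull
    (f.support.finite_toSet.image expVec) hv
  have hsum : ∀ x : Fin n → ℝ, l x = ∑ j, x j * l (Pi.single j 1) := fun x => by
    conv_lhs => rw [pi_eq_sum_univ' x]
    simp [map_sum]
  have hw : ∀ β ∈ f.support, β ≠ α →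
      ∑ j, expVec β j * l (Pi.single j 1) < ∑ j, expVec α j * l (Pi.single j 1) := by
    intro β hβ hne
    rw [← hsum, ← hsum]
    exact hl _ ⟨β, hβ, rfl⟩ (expVec_injective.ne hne)
  have hnonneg : ∀ ε : Fin n → ℝ, 0 ≤ f.coeff α * ∏ j, ε j ^ α j := fun ε =>
    ge_of_tendsto' (tendsto_exp_mul_eval hα _ ε hw) fun t =>
      mul_nonneg (Real.exp_pos _).le (hf _)
  have hpos : 0 < f.coeff α :=
    lt_of_le_of_ne (by simpa using hnonneg 1) (MvPolynomial.mem_support_iff.1 hα).symm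
  have heven : Even (α i) := by
    by_contra hodd
    have hneg := hnonneg (Function.update 1 i (-1))
    rw [Finset.prod_eq_single i (fun j _ hj => by simp [hj]) (by simp), Function.update_self,
      (Nat.not_even_iff_odd.1 hodd).neg_one_pow] at hneg
    linarith
  obtain ⟨m, hm⟩ := heven
  exact ⟨m, by simp [expVec, hm, two_mul]⟩
end
end
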